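/- Let −∞ ≤ a < 0 < b ≤ ∞ and let w : (a,b) → (0,∞) be a continuous integrable function such that x ↦ log w(x) is concave on (a,b), ∫_a^b w(x) dx = 1, and ∫_a^b x·w(x) dx = 0. Define R : ℝ → [0,1] by R(x) := ∫_a^{min(x,b)} w(s) ds for a < x and extended by 0 below a and 1 above b, set c := w(0)/R(0), and define F : ℝ → [0,1] by F(x) := e^{c·x − 1} for x ≤ 1/c and F(x) := 1 for x > 1/c. If R(0) ≤ (1+ε)·e^{-1} for some ε > 0, then ∫_ℝ |R(x) − F(x)| dx ≤ (4√3/e)·(1+ε)·log(1+ε)·(∫_a^b x²·w(x) dx)^{1/2}. -/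

import Mathlib

open MeasureTheory

/-- The set of real numbers lying strictly between two extended real numbers. -/
def erealIoo (a b : EReal) : Set ℝ := {x : ℝ | a < (x : EReal) ∧ (x : EReal) < b}

theorem le_of_hasDerivAt_le {f g f' g' : ℝ → ℝ} (hf : ∀ x, HasDerivAt f (f' x) x)
    (hg : ∀ x, HasDerivAt g (g' x) x) (h0 : f 0 ≤ g 0) (h : ∀ x, 0 ≤ x → f' x ≤ g' x)
    {x : ℝ} (hx : 0 ≤ x) : f x ≤ g x := by
  have hmono : MonotoneOn (fun y => g y - f y) (Set.Ici 0) := by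
    refine monotoneOn_of_hasDerivWithinAt_nonneg (convex_Ici 0) (f' := fun y => g' y - f' y)
      (fun y _ => ((hg y).sub (hf y)).continuousAt.continuousWithinAt)
      (fun y _ => ((hg y).sub (hf y)).hasDerivWithinAt) fun y hy => ?_
    rw [interior_Ici] at hy
    exact sub_nonneg.2 (h y (le_of_lt hy))
  have := hmono Set.self_mem_Ici hx hx
  simp only at this
  linarith

theorem sinh_le_mul_cosh {x : ℝ} (hx : 0 ≤ x) : Real.sinh x ≤ x * Real.cosh x :=
  le_of_hasDerivAt_le (g' := fun x => 1 * Real.cosh x + x * Real.sinh x) Real.hasDerivAt_sinh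
    (fun x => (hasDerivAt_id x).mul (Real.hasDerivAt_cosh x)) (by simp)
    (fun x hx => by nlinarith [mul_nonneg hx (Real.sinh_nonneg_iff.2 hx)]) hx

theorem one_add_sq_div_two_le_cosh {x : ℝ} (hx : 0 ≤ x) : 1 + x ^ 2 / 2 ≤ Real.cosh x :=
  le_of_hasDerivAt_le (f := fun x => 1 + x ^ 2 / 2) (f' := fun x => x)
    (fun x => by simpa using (((hasDerivAt_id x).pow 2).div_const 2).const_add 1)
    Real.hasDerivAt_cosh (by simp) (fun x hx => Real.self_le_sinh_iff.2 hx) hx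

theorem add_cube_div_six_le_sinh {x : ℝ} (hx : 0 ≤ x) : x + x ^ 3 / 6 ≤ Real.sinh x :=
  le_of_hasDerivAt_le (f := fun x => x + x ^ 3 / 6) (f' := fun x => 1 + x ^ 2 / 2)
    (fun x => by
      have h := (hasDerivAt_id x).add (((hasDerivAt_id x).pow 3).div_const 6)
      refine h.congr_deriv ?_
      simp only [id]
      ring)
    Real.hasDerivAt_sinh (by simp) (fun x hx => one_add_sq_div_two_le_cosh hx) hx

theorem two_mul_sinh_sq_le {x : ℝ} (hx : 0 ≤ x) :
    2 * Real.sinh x ^ 2 ≤ x * (Real.sinh x * Real.cosh x) + x ^ 2 := by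
  have key : ∀ y : ℝ, 0 ≤ y →
      3 * (Real.sinh y * Real.cosh y) ≤ y * (2 * Real.sinh y ^ 2 + 3) := by
    intro y hy
    refine le_of_hasDerivAt_le (f := fun y => 3 * (Real.sinh y * Real.cosh y))
      (g := fun y => y * (2 * Real.sinh y ^ 2 + 3))
      (fun y => ((Real.hasDerivAt_sinh y).mul (Real.hasDerivAt_cosh y)).const_mul 3)
      (fun y => (hasDerivAt_id y).mul
        ((((Real.hasDerivAt_sinh y).pow 2).const_mul 2).add_const 3)) (by simp) ?_ hy
    intro z hz
    have h1 := mul_nonneg (Real.sinh_nonneg_iff.2 hz) (sub_nonneg.2 (sinh_le_mul_cosh hz))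
    have h2 := Real.cosh_sq z
    simp only [id]
    norm_num
    nlinarith
  refine le_of_hasDerivAt_le (f := fun y => 2 * Real.sinh y ^ 2)
    (g := fun x => x * (Real.sinh x * Real.cosh x) + x ^ 2)
    (fun y => ((Real.hasDerivAt_sinh y).pow 2).const_mul 2)
    (fun y => ((hasDerivAt_id y).mul ((Real.hasDerivAt_sinh y).mul (Real.hasDerivAt_cosh y))).add
      ((hasDerivAt_id y).pow 2)) (by simp) ?_ hx
  intro z hz
  have h1 := key z hz
  have h2 := Real.cosh_sq z
  simp only [id]
  norm_num
  nlinarith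

theorem sq_add_pow_four_div_three_le_sinh_sq {x : ℝ} (hx : 0 ≤ x) :
    x ^ 2 + x ^ 4 / 3 ≤ Real.sinh x ^ 2 := by
  have h := add_cube_div_six_le_sinh hx
  have h3 : 0 ≤ x ^ 3 := by positivity
  calc x ^ 2 + x ^ 4 / 3 ≤ (x + x ^ 3 / 6) ^ 2 := by nlinarith [sq_nonneg (x ^ 3)]
    _ ≤ _ := by gcongr

theorem sq_lt_sinh_sq {x : ℝ} (hx : 0 < x) : x ^ 2 < Real.sinh x ^ 2 := by
  have := sq_add_pow_four_div_three_le_sinh_sq hx.le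
  have : 0 < x ^ 4 := by positivity
  linarith

/-- The logarithm of `3` times the squared product of the standard deviation of a truncated
exponential density with its value at the mean is monotone in the truncation parameter. -/
theorem monotoneOn_log_truncated_exponential :
    MonotoneOn (fun x : ℝ => 2 * (x * Real.cosh x / Real.sinh x - 1)
      + Real.log (Real.sinh x ^ 2 - x ^ 2) - 4 * Real.log (Real.sinh x)) (Set.Ioi 0) := by
  have hder : ∀ x ∈ Set.Ioi (0 : ℝ), HasDerivAt (fun x : ℝ =>
      2 * (x * Real.cosh x / Real.sinh x - 1)
      + Real.log (Real.sinh x ^ 2 - x ^ 2) - 4 * Real.log (Real.sinh x))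
      (2 * x * (x * (Real.sinh x * Real.cosh x) + x ^ 2 - 2 * Real.sinh x ^ 2) /
        (Real.sinh x ^ 2 * (Real.sinh x ^ 2 - x ^ 2))) x := by
    intro x hx
    have hs : 0 < Real.sinh x := Real.sinh_pos_iff.2 hx
    have hd : 0 < Real.sinh x ^ 2 - x ^ 2 := sub_pos.2 (sq_lt_sinh_sq hx)
    have h1 := ((((hasDerivAt_id x).mul (Real.hasDerivAt_cosh x)).div
      (Real.hasDerivAt_sinh x) hs.ne').sub_const 1).const_mul 2
    have h2 := (((Real.hasDerivAt_sinh x).pow 2).sub ((hasDerivAt_id x).pow 2)).log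
      (by simpa using hd.ne')
    have h3 := ((Real.hasDerivAt_sinh x).log hs.ne').const_mul 4
    refine ((h1.add h2).sub h3).congr_deriv ?_
    have hc := Real.cosh_sq x
    simp only [id, Pi.sub_apply, Pi.pow_apply, Pi.mul_apply]
    norm_num
    have hd' := hd.ne'
    field_simp
    rw [hc]
    ring
  refine monotoneOn_of_hasDerivWithinAt_nonneg (convex_Ioi 0)
    (fun x hx => (hder x hx).continuousAt.continuousWithinAt)
    (fun x hx => (hder x (interior_subset hx)).hasDerivWithinAt) fun x hx => ?_
  have hx : 0 < x := interior_subset hx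
  have hd : 0 < Real.sinh x ^ 2 - x ^ 2 := sub_pos.2 (sq_lt_sinh_sq hx)
  have := sub_nonneg.2 (two_mul_sinh_sq_le hx.le)
  positivity

theorem sinh_pow_four_mul_exp_le {x : ℝ} (hx : 0 < x) :
    Real.sinh x ^ 4 * Real.exp (2 * (1 - x * Real.cosh x / Real.sinh x)) ≤
      3 * (Real.sinh x ^ 2 - x ^ 2) := by
  have hs : 0 < Real.sinh x := Real.sinh_pos_iff.2 hx
  have hd : 0 < Real.sinh x ^ 2 - x ^ 2 := sub_pos.2 (sq_lt_sinh_sq hx)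
  set Φ := 2 * (x * Real.cosh x / Real.sinh x - 1)
      + Real.log (Real.sinh x ^ 2 - x ^ 2) - 4 * Real.log (Real.sinh x) with hΦ
  have hlow : ∀ y ∈ Set.Ioo 0 x, -Real.log 3 - 4 * Real.log (Real.cosh y) ≤ Φ := by
    intro y ⟨hy, hyx⟩
    refine le_trans ?_ (monotoneOn_log_truncated_exponential hy hx hyx.le)
    have hsy : 0 < Real.sinh y := Real.sinh_pos_iff.2 hy
    have hsc := sinh_le_mul_cosh hy.le
    have h1 : 0 ≤ y * Real.cosh y / Real.sinh y - 1 := by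
      rw [sub_nonneg, one_le_div hsy]; exact hsc
    have h2 : Real.log (y ^ 4 / 3) ≤ Real.log (Real.sinh y ^ 2 - y ^ 2) := by
      apply Real.log_le_log (by positivity)
      linarith [sq_add_pow_four_div_three_le_sinh_sq hy.le]
    have h3 : Real.log (Real.sinh y) ≤ Real.log y + Real.log (Real.cosh y) := by
      rw [← Real.log_mul hy.ne' (Real.cosh_pos y).ne']
      exact Real.log_le_log hsy hsc
    rw [Real.log_div (by positivity) (by norm_num), Real.log_pow] at h2
    push_cast at h2
    linarith
  have hlim : Filter.Tendsto (fun y => -Real.log 3 - 4 * Real.log (Real.cosh y))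
      (nhdsWithin 0 (Set.Ioi 0)) (nhds (-Real.log 3)) := by
    have hc : Continuous fun y => -Real.log 3 - 4 * Real.log (Real.cosh y) :=
      continuous_const.sub (continuous_const.mul
        (Real.continuous_cosh.log fun y => (Real.cosh_pos y).ne'))
    have := hc.tendsto 0
    simp only [Real.cosh_zero, Real.log_one, mul_zero, sub_zero] at this
    exact this.mono_left nhdsWithin_le_nhds
  have hΦ3 : -Real.log 3 ≤ Φ := le_of_tendsto hlim
    (Filter.eventually_of_mem (Ioo_mem_nhdsGT hx) hlow)
  have hexp : Real.sinh x ^ 4 * Real.exp (2 * (1 - x * Real.cosh x / Real.sinh x)) =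
      Real.exp (4 * Real.log (Real.sinh x) + 2 * (1 - x * Real.cosh x / Real.sinh x)) := by
    have h4 : Real.exp (4 * Real.log (Real.sinh x)) = Real.sinh x ^ 4 := by
      rw [← Real.exp_log hs, ← Real.exp_nat_mul, Real.exp_log hs]
      norm_num
    rw [Real.exp_add, h4]
  rw [hexp, ← Real.le_log_iff_exp_le (by positivity), Real.log_mul (by norm_num) hd.ne']
  linarith

theorem exists_two_mul_sinh_mul_exp_eq {y : ℝ} (hy : 0 < y) (hy' : y < Real.exp 1) :
    ∃ x, 0 < x ∧ 2 * Real.sinh x * Real.exp (1 - x * Real.cosh x / Real.sinh x) = y := by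
  have hcont : ContinuousOn
      (fun x => 2 * Real.sinh x * Real.exp (1 - x * Real.cosh x / Real.sinh x)) (Set.Ioi 0) := by
    refine (continuous_const.mul Real.continuous_sinh).continuousOn.mul
      (Real.continuous_exp.comp_continuousOn (continuousOn_const.sub ?_))
    exact ((continuous_id.mul Real.continuous_cosh).continuousOn).div
      Real.continuous_sinh.continuousOn fun x hx => (Real.sinh_pos_iff.2 hx).ne'
  have h0 : Filter.Tendsto
      (fun x => 2 * Real.sinh x * Real.exp (1 - x * Real.cosh x / Real.sinh x))
      (nhdsWithin 0 (Set.Ioi 0)) (nhds 0) := by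
    have hl : Filter.Tendsto (fun x => 2 * Real.sinh x) (nhdsWithin 0 (Set.Ioi 0)) (nhds 0) := by
      have hc : Continuous fun x => 2 * Real.sinh x := continuous_const.mul Real.continuous_sinh
      simpa using (hc.tendsto 0).mono_left nhdsWithin_le_nhds
    refine tendsto_of_tendsto_of_tendsto_of_le_of_le' tendsto_const_nhds hl ?_ ?_ <;>
      filter_upwards [self_mem_nhdsWithin] with x hx <;>
      have hs : 0 < Real.sinh x := Real.sinh_pos_iff.2 hx
    · positivity
    · have : Real.exp (1 - x * Real.cosh x / Real.sinh x) ≤ 1 := by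
        rw [Real.exp_le_one_iff, sub_nonpos, one_le_div hs]
        exact sinh_le_mul_cosh (le_of_lt hx)
      nlinarith
  have hinf : Filter.Tendsto
      (fun x => 2 * Real.sinh x * Real.exp (1 - x * Real.cosh x / Real.sinh x))
      Filter.atTop (nhds (Real.exp 1)) := by
    have he : Filter.Tendsto (fun x : ℝ => Real.exp (-(2 * x))) Filter.atTop (nhds 0) :=
      Real.tendsto_exp_neg_atTop_nhds_zero.comp
        (Filter.tendsto_id.const_mul_atTop (by norm_num))
    have hxe : Filter.Tendsto (fun x : ℝ => 2 * x * Real.exp (-(2 * x))) Filter.atTop (nhds 0) := by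
      have := (Real.tendsto_pow_mul_exp_neg_atTop_nhds_zero 1).comp
        (Filter.tendsto_id.const_mul_atTop (by norm_num : (0 : ℝ) < 2))
      simpa [Function.comp_def] using this
    have h1 := he.const_sub 1
    have h2 := (((hxe.div h1 (by norm_num)).const_sub 1).rexp).mul h1
    simp only [sub_zero, div_one, mul_one] at h2
    refine h2.congr' ?_
    filter_upwards [Filter.eventually_gt_atTop 0] with x hx
    have hs : 0 < Real.sinh x := Real.sinh_pos_iff.2 hx
    have hE : Real.exp (-(2 * x)) = Real.exp (-x) ^ 2 := by
      rw [← Real.exp_nat_mul]; congr 1; push_cast; ring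
    have hmul : Real.exp x * Real.exp (-x) = 1 := by rw [← Real.exp_add]; simp
    have hsinh : 2 * Real.sinh x = Real.exp x * (1 - Real.exp (-(2 * x))) := by
      rw [Real.sinh_eq, hE]
      linear_combination Real.exp (-x) * hmul
    have hpos : 0 < 1 - Real.exp (-(2 * x)) := by
      rw [sub_pos, Real.exp_lt_one_iff]; linarith
    have harg : 1 - x * Real.cosh x / Real.sinh x =
        1 - 2 * x * Real.exp (-(2 * x)) / (1 - Real.exp (-(2 * x))) - x := by
      have hcosh : 2 * Real.cosh x = Real.exp x * (1 + Real.exp (-(2 * x))) := by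
        rw [Real.cosh_eq, hE]
        linear_combination -Real.exp (-x) * hmul
      have : x * Real.cosh x / Real.sinh x =
          x * (Real.exp x * (1 + Real.exp (-(2 * x)))) /
            (Real.exp x * (1 - Real.exp (-(2 * x)))) := by
        rw [← hsinh, ← hcosh]; field_simp
      have hne := hpos.ne'
      clear hE hsinh hcosh hpos
      rw [this, mul_left_comm, mul_div_mul_left _ _ (Real.exp_pos x).ne']
      generalize Real.exp (-(2 * x)) = E at *
      field_simp
      ring
    rw [harg, hsinh, Real.exp_sub _ x, Pi.div_apply]
    have := Real.exp_ne_zero x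
    generalize Real.exp (1 - 2 * x * Real.exp (-(2 * x)) / (1 - Real.exp (-(2 * x)))) = A
    field_simp
  obtain ⟨x, hx, hxy⟩ := (isPreconnected_Ioi (a := (0 : ℝ))).intermediate_value_Ioo
    (Filter.le_principal_iff.2 self_mem_nhdsWithin)
    (Filter.le_principal_iff.2 (Filter.Ioi_mem_atTop 0)) hcont h0 hinf ⟨hy, hy'⟩
  exact ⟨x, hx, hxy⟩

theorem sub_integral_sq_mul_le {f : ℝ → ℝ} {p k m l : ℝ} (hf0 : ∀ x, 0 ≤ f x)
    (hf : ∀ x, f x ≤ p * Real.exp (k * x)) (hi : Integrable f) (hi1 : Integrable fun x => x * f x)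
    (hi2 : Integrable fun x => x ^ 2 * f x) (hmass : ∫ x, f x = 1) (hbar : ∫ x, x * f x = 0)
    (hl : 0 ≤ l) :
    l ^ 2 - m ^ 2 - ∫ x, x ^ 2 * f x ≤
      p * ∫ x in (m - l)..(m + l), (l ^ 2 - (x - m) ^ 2) * Real.exp (k * x) := by
  have hexp : (fun x => (l ^ 2 - (x - m) ^ 2) * f x) =
      fun x => (l ^ 2 - m ^ 2) * f x + 2 * m * (x * f x) - x ^ 2 * f x := by
    ext x; ring
  have hii : Integrable fun x => (l ^ 2 - (x - m) ^ 2) * f x := by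
    rw [hexp]; exact ((hi.const_mul _).add (hi1.const_mul _)).sub hi2
  have hval : ∫ x, (l ^ 2 - (x - m) ^ 2) * f x = l ^ 2 - m ^ 2 - ∫ x, x ^ 2 * f x := by
    rw [hexp, integral_sub (by exact (hi.const_mul _).add (hi1.const_mul _)) hi2,
      integral_add (hi.const_mul _) (hi1.const_mul _), integral_const_mul, integral_const_mul,
      hmass, hbar]
    ring
  have hcont : Continuous fun x => p * ((l ^ 2 - (x - m) ^ 2) * Real.exp (k * x)) := by fun_prop
  rw [← hval, ← intervalIntegral.integral_const_mul, intervalIntegral.integral_of_le (by linarith),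
    ← integral_indicator measurableSet_Ioc]
  refine integral_mono hii ((integrable_indicator_iff measurableSet_Ioc).2
    (hcont.integrableOn_Ioc)) fun x => ?_
  by_cases hx : x ∈ Set.Ioc (m - l) (m + l)
  · rw [Set.indicator_of_mem hx]
    have h1 : 0 ≤ l ^ 2 - (x - m) ^ 2 := by nlinarith [hx.1, hx.2]
    have := mul_le_mul_of_nonneg_left (hf x) h1
    simp only
    linarith
  · rw [Set.indicator_of_notMem hx]
    have h1 : l ^ 2 - (x - m) ^ 2 ≤ 0 := by
      rw [Set.mem_Ioc, not_and_or, not_lt, not_le] at hx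
      rcases hx with hx | hx <;> nlinarith
    exact mul_nonpos_of_nonpos_of_nonneg h1 (hf0 x)

theorem integral_sq_sub_sq_mul_exp {k m l : ℝ} (hk : k ≠ 0) :
    ∫ x in (m - l)..(m + l), (l ^ 2 - (x - m) ^ 2) * Real.exp (k * x) =
      4 * Real.exp (k * m) * (k * l * Real.cosh (k * l) - Real.sinh (k * l)) / k ^ 3 := by
  have hder : ∀ x, HasDerivAt (fun x => ((l ^ 2 - (x - m) ^ 2) / k + 2 * (x - m) / k ^ 2
      - 2 / k ^ 3) * Real.exp (k * x)) ((l ^ 2 - (x - m) ^ 2) * Real.exp (k * x)) x := by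
    intro x
    have hxm := (hasDerivAt_id x).sub_const m
    have h := ((((hxm.pow 2).const_sub (l ^ 2)).div_const k).add
      ((hxm.const_mul 2).div_const (k ^ 2))).sub_const (2 / k ^ 3)
    refine (h.mul ((hasDerivAt_id x).const_mul k).exp).congr_deriv ?_
    simp only [id, Pi.pow_apply, Pi.add_apply]
    field_simp
    norm_num
    ring
  rw [intervalIntegral.integral_eq_sub_of_hasDerivAt (fun x _ => hder x)
    (by apply Continuous.intervalIntegrable; fun_prop), Real.cosh_eq, Real.sinh_eq]
  have h1 : Real.exp (k * (m + l)) = Real.exp (k * m) * Real.exp (k * l) := by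
    rw [← Real.exp_add]; ring_nf
  have h2 : Real.exp (k * (m - l)) = Real.exp (k * m) * Real.exp (-(k * l)) := by
    rw [← Real.exp_add]; ring_nf
  rw [h1, h2]
  generalize Real.exp (k * m) = A
  generalize Real.exp (k * l) = B
  generalize Real.exp (-(k * l)) = C
  field_simp
  ring

theorem rate_le_mul_exp_one {f : ℝ → ℝ} {p k : ℝ} (hk : 0 < k) (hf0 : ∀ x, 0 ≤ f x)
    (hf : ∀ x, f x ≤ p * Real.exp (k * x)) (hi : Integrable f) (hi1 : Integrable fun x => x * f x)
    (hmass : ∫ x, f x = 1) (hbar : ∫ x, x * f x = 0) : k ≤ p * Real.exp 1 := by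
  have hp : 0 ≤ p := by simpa using (hf0 0).trans (hf 0)
  have hder : ∀ x, HasDerivAt (fun x => p * (((k⁻¹ - x) / k + 1 / k ^ 2) * Real.exp (k * x)))
      (p * ((k⁻¹ - x) * Real.exp (k * x))) x := by
    intro x
    have h := ((((hasDerivAt_id x).const_sub k⁻¹).div_const k).add_const (1 / k ^ 2))
    refine ((h.mul ((hasDerivAt_id x).const_mul k).exp).const_mul p).congr_deriv ?_
    simp only [id]
    field_simp
    ring
  have hexp : (fun x => (k⁻¹ - x) * f x) = fun x => k⁻¹ * f x - x * f x := by ext x; ring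
  have hii : Integrable fun x => (k⁻¹ - x) * f x := by
    rw [hexp]; exact (hi.const_mul _).sub hi1
  have hval : ∫ x, (k⁻¹ - x) * f x = k⁻¹ := by
    rw [hexp, integral_sub (hi.const_mul _) hi1, integral_const_mul, hmass, hbar]
    ring
  have hle : k⁻¹ ≤ ∫ x in Set.Iic k⁻¹, (k⁻¹ - x) * f x := by
    rw [← integral_indicator measurableSet_Iic]
    refine hval.symm.trans_le (integral_mono hii (hii.indicator measurableSet_Iic) fun x => ?_)
    by_cases hx : x ≤ k⁻¹
    · rw [Set.indicator_of_mem (Set.mem_Iic.2 hx)]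
    · rw [Set.indicator_of_notMem (by simpa using hx)]
      exact mul_nonpos_of_nonpos_of_nonneg (by linarith) (hf0 x)
  have hbound : ∫ x in Set.Iic k⁻¹, (k⁻¹ - x) * f x ≤ p * (Real.exp 1 / k ^ 2) := by
    refine le_of_tendsto (intervalIntegral_tendsto_integral_Iic k⁻¹ hii.integrableOn
      Filter.tendsto_id) ?_
    filter_upwards [Filter.Iic_mem_atBot k⁻¹] with a ha
    have hcont : Continuous fun x => p * ((k⁻¹ - x) * Real.exp (k * x)) := by fun_prop
    calc ∫ x in a..k⁻¹, (k⁻¹ - x) * f x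
        ≤ ∫ x in a..k⁻¹, p * ((k⁻¹ - x) * Real.exp (k * x)) := by
          refine intervalIntegral.integral_mono_on ha hii.intervalIntegrable
            (hcont.intervalIntegrable _ _) fun x hx => ?_
          have := mul_le_mul_of_nonneg_left (hf x) (sub_nonneg.2 hx.2)
          linarith
      _ ≤ _ := by
          rw [intervalIntegral.integral_eq_sub_of_hasDerivAt (fun x _ => hder x)
            (hcont.intervalIntegrable _ _)]
          have : 0 ≤ p * (((k⁻¹ - a) / k + 1 / k ^ 2) * Real.exp (k * a)) := by
            have := sub_nonneg.2 (Set.mem_Iic.1 ha)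
            positivity
          rw [sub_self, zero_div, zero_add, mul_inv_cancel₀ hk.ne', one_div_mul_eq_div]
          linarith
  have := hle.trans hbound
  rw [← mul_div_assoc, le_div_iff₀ (by positivity)] at this
  have h2 : k⁻¹ * k ^ 2 = k := by field_simp
  linarith

theorem one_le_twelve_mul_sq_mul_integral_aux {f : ℝ → ℝ} {p k : ℝ} (hp : 0 < p) (hk : 0 < k)
    (hkp : k < p * Real.exp 1) (hf0 : ∀ x, 0 ≤ f x)
    (hf : ∀ x, f x ≤ p * Real.exp (k * x)) (hi : Integrable f) (hi1 : Integrable fun x => x * f x)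
    (hi2 : Integrable fun x => x ^ 2 * f x) (hmass : ∫ x, f x = 1) (hbar : ∫ x, x * f x = 0) :
    1 ≤ 12 * p ^ 2 * ∫ x, x ^ 2 * f x := by
  obtain ⟨t, ht, hteq⟩ := exists_two_mul_sinh_mul_exp_eq (y := k / p) (by positivity)
    (by rwa [div_lt_iff₀ hp, mul_comm])
  have hs : 0 < Real.sinh t := Real.sinh_pos_iff.2 ht
  have hineq := sinh_pow_four_mul_exp_le ht
  set μ := 1 - t * Real.cosh t / Real.sinh t with hμ
  have hmain := sub_integral_sq_mul_le (m := μ / k) (l := t / k) hf0 hf hi hi1 hi2 hmass hbar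
    (by positivity)
  rw [integral_sq_sub_sq_mul_exp hk.ne', mul_div_cancel₀ _ hk.ne',
    mul_div_cancel₀ _ hk.ne'] at hmain
  set σ := ∫ x, x ^ 2 * f x
  have hkeq : k = p * (2 * Real.sinh t * Real.exp μ) := by rw [hteq]; field_simp
  have hμS : μ * Real.sinh t = Real.sinh t - t * Real.cosh t := by rw [hμ]; field_simp
  have hrhs : p * (4 * Real.exp μ * (t * Real.cosh t - Real.sinh t) / k ^ 3) = -2 * μ / k ^ 2 := by
    have h1 : t * Real.cosh t - Real.sinh t = -(μ * Real.sinh t) := by linarith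
    have h2 : p * (4 * Real.exp μ * (t * Real.cosh t - Real.sinh t) / k ^ 3) =
        -2 * μ * (p * (2 * Real.sinh t * Real.exp μ)) / k ^ 3 := by rw [h1]; ring
    rw [h2, ← hkeq]
    field_simp
  rw [hrhs] at hmain
  have hks : 1 - t ^ 2 / Real.sinh t ^ 2 ≤ k ^ 2 * σ := by
    have h1 : k ^ 2 * ((t / k) ^ 2 - (μ / k) ^ 2 - σ) ≤ k ^ 2 * (-2 * μ / k ^ 2) :=
      mul_le_mul_of_nonneg_left hmain (by positivity)
    have h2 : k ^ 2 * ((t / k) ^ 2 - (μ / k) ^ 2 - σ) = t ^ 2 - μ ^ 2 - k ^ 2 * σ := by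
      field_simp
    have h3 : k ^ 2 * (-2 * μ / k ^ 2) = -2 * μ := by field_simp
    have h4 : t ^ 2 - μ ^ 2 + 2 * μ = 1 - t ^ 2 / Real.sinh t ^ 2 := by
      rw [hμ]
      field_simp
      linear_combination -t ^ 2 * Real.cosh_sq t
    linarith
  have hk2 : k ^ 2 = 4 * p ^ 2 * Real.sinh t ^ 2 * Real.exp (2 * μ) := by
    rw [hkeq, two_mul μ, Real.exp_add]; ring
  have hfin : k ^ 2 ≤ k ^ 2 * (12 * p ^ 2 * σ) := by
    calc k ^ 2 = 4 * p ^ 2 / Real.sinh t ^ 2 * (Real.sinh t ^ 4 * Real.exp (2 * μ)) := by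
          rw [hk2]; field_simp
      _ ≤ 4 * p ^ 2 / Real.sinh t ^ 2 * (3 * (Real.sinh t ^ 2 - t ^ 2)) := by gcongr
      _ = 12 * p ^ 2 * (1 - t ^ 2 / Real.sinh t ^ 2) := by field_simp; ring
      _ ≤ 12 * p ^ 2 * (k ^ 2 * σ) := by gcongr
      _ = _ := by ring
  exact le_of_mul_le_mul_left (by simpa using hfin) (by positivity : 0 < k ^ 2)

/-- Among the densities of mean zero below a given exponential `p * exp (k * x)`, the variance is
at least that of the uniform density of height `p`. -/
theorem one_le_twelve_mul_sq_mul_integral {f : ℝ → ℝ} {p k : ℝ} (hp : 0 < p)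
    (hf0 : ∀ x, 0 ≤ f x) (hf : ∀ x, f x ≤ p * Real.exp (k * x)) (hi : Integrable f)
    (hi1 : Integrable fun x => x * f x) (hi2 : Integrable fun x => x ^ 2 * f x)
    (hmass : ∫ x, f x = 1) (hbar : ∫ x, x * f x = 0) :
    1 ≤ 12 * p ^ 2 * ∫ x, x ^ 2 * f x := by
  have hpos : ∀ {g : ℝ → ℝ} {k : ℝ}, 0 < k → (∀ x, 0 ≤ g x) →
      (∀ x, g x ≤ p * Real.exp (k * x)) → Integrable g → (Integrable fun x => x * g x) →
      (Integrable fun x => x ^ 2 * g x) → ∫ x, g x = 1 → ∫ x, x * g x = 0 →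
      1 ≤ 12 * p ^ 2 * ∫ x, x ^ 2 * g x := by
    intro g k hk hg0 hg hi hi1 hi2 hmass hbar
    have hlt : ∀ q, p < q → 1 ≤ 12 * q ^ 2 * ∫ x, x ^ 2 * g x := fun q hq =>
      one_le_twelve_mul_sq_mul_integral_aux (hp.trans hq) hk
        ((rate_le_mul_exp_one hk hg0 hg hi hi1 hmass hbar).trans_lt (by gcongr)) hg0
        (fun x => (hg x).trans (by gcongr)) hi hi1 hi2 hmass hbar
    have hc : Continuous fun q : ℝ => 12 * q ^ 2 * ∫ x, x ^ 2 * g x := by fun_prop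
    exact ge_of_tendsto ((hc.tendsto p).mono_left (nhdsWithin_le_nhds (s := Set.Ioi p)))
      (Filter.eventually_of_mem self_mem_nhdsWithin hlt)
  rcases lt_trichotomy k 0 with hk | rfl | hk
  · have h := hpos (g := fun x => f (-x)) (neg_pos.2 hk) (fun x => hf0 _)
      (fun x => by simpa using hf (-x)) hi.comp_neg
      (by simpa using hi1.comp_neg.neg) (by simpa using hi2.comp_neg)
      (by rwa [integral_neg_eq_self f volume])
      (by
        have := integral_neg_eq_self (fun x => x * f x) volume
        rw [hbar] at this
        simpa [integral_neg] using this)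
    have h2 := integral_neg_eq_self (fun x => x ^ 2 * f x) volume
    simp only [even_two, Even.neg_pow] at h2
    rwa [h2] at h
  · have h := sub_integral_sq_mul_le (m := 0) (l := 1 / (2 * p)) hf0 hf hi hi1 hi2 hmass hbar
      (by positivity)
    have hval : ∫ x in (0 - 1 / (2 * p))..(0 + 1 / (2 * p)),
        ((1 / (2 * p)) ^ 2 - (x - 0) ^ 2) * Real.exp (0 * x) = 4 / 3 * (1 / (2 * p)) ^ 3 := by
      simp only [zero_mul, Real.exp_zero, mul_one, sub_zero]
      rw [intervalIntegral.integral_sub (by simp) (by simp), integral_pow]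
      simp
      ring
    rw [hval] at h
    set σ := ∫ x, x ^ 2 * f x
    have h1 : (1 / (2 * p)) ^ 2 - p * (4 / 3 * (1 / (2 * p)) ^ 3) = 1 / (12 * p ^ 2) := by
      field_simp; norm_num
    have h2 : 1 / (12 * p ^ 2) ≤ σ := by rw [← h1]; linarith
    rwa [div_le_iff₀' (by positivity)] at h2
  · exact hpos hk hf0 hf hi hi1 hi2 hmass hbar

theorem exists_le_mul_exp_of_concaveOn_log {S : Set ℝ} {w : ℝ → ℝ} (hS : IsOpen S)
    (h0 : (0 : ℝ) ∈ S) (hw : ∀ x ∈ S, 0 < w x) (hconc : ConcaveOn ℝ S fun x => Real.log (w x)) :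
    ∃ k : ℝ, ∀ x ∈ S, w x ≤ w 0 * Real.exp (k * x) := by
  have hcv := hconc.neg
  have hint : (0 : ℝ) ∈ interior S := by rwa [hS.interior_eq]
  refine ⟨-derivWithin (-fun x => Real.log (w x)) (Set.Ioi 0) 0, fun x hx => ?_⟩
  set d := derivWithin (-fun x => Real.log (w x)) (Set.Ioi 0) 0
  suffices h : Real.log (w x) ≤ Real.log (w 0) + -d * x by
    rwa [← Real.exp_le_exp, Real.exp_add, Real.exp_log (hw x hx), Real.exp_log (hw 0 h0)] at h
  rcases lt_trichotomy x 0 with hx0 | rfl | hx0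
  · have h := (hcv.slope_le_leftDeriv_of_mem_interior hx hint hx0).trans
      (hcv.leftDeriv_le_rightDeriv_of_mem_interior hint)
    rw [slope_def_field, div_le_iff₀ (by linarith)] at h
    simp only [Pi.neg_apply] at h
    linarith
  · simp
  · have h := hcv.rightDeriv_le_slope_of_mem_interior hint hx hx0
    rw [slope_def_field, le_div_iff₀ (by linarith)] at h
    simp only [Pi.neg_apply] at h
    linarith

theorem indicator_sub_mul_le_of_concaveOn_log {S : Set ℝ} {w : ℝ → ℝ}
    (hw : ∀ x ∈ S, 0 < w x) (hconc : ConcaveOn ℝ S fun x => Real.log (w x)) {x y u d : ℝ}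
    (hx : x ∈ S) (hy : y ∈ S) (hd : 0 < d) (hxy : y = x + d) (hu : u ≤ x) :
    S.indicator w u * w y ≤ S.indicator w (u + d) * w x := by
  by_cases huS : u ∈ S
  · have hudS : u + d ∈ S := hconc.1.ordConnected.out huS hy ⟨by linarith, by linarith⟩
    rw [Set.indicator_of_mem huS, Set.indicator_of_mem hudS]
    have hpos : 0 < y - u := by linarith
    set θ := d / (y - u) with hθ
    have hθ0 : 0 ≤ θ := by positivity
    have hθ1 : 0 ≤ 1 - θ := by rw [sub_nonneg, hθ, div_le_one hpos]; linarith
    have hθm : θ * (y - u) = d := by rw [hθ]; field_simp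
    have h1 := hconc.2 huS hy hθ0 hθ1 (by ring)
    have h2 := hconc.2 huS hy hθ1 hθ0 (by ring)
    have e1 : θ • u + (1 - θ) • y = x := by simp only [smul_eq_mul]; linarith
    have e2 : (1 - θ) • u + θ • y = u + d := by simp only [smul_eq_mul]; linarith
    rw [e1] at h1
    rw [e2] at h2
    simp only [smul_eq_mul] at h1 h2
    rw [← Real.log_le_log_iff (mul_pos (hw _ huS) (hw _ hy)) (mul_pos (hw _ hudS) (hw _ hx)),
      Real.log_mul (hw _ huS).ne' (hw _ hy).ne', Real.log_mul (hw _ hudS).ne' (hw _ hx).ne']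
    linarith
  · rw [Set.indicator_of_notMem huS, zero_mul]
    exact mul_nonneg (Set.indicator_nonneg (fun z hz => (hw z hz).le) _) (hw _ hx).le

/-- The density of a log-concave law divided by its distribution function is nonincreasing. -/
theorem integral_Iio_indicator_mul_le_of_concaveOn_log {S : Set ℝ} {w : ℝ → ℝ}
    (hw : ∀ x ∈ S, 0 < w x) (hconc : ConcaveOn ℝ S fun x => Real.log (w x))
    (hi : Integrable (S.indicator w)) {x y : ℝ} (hx : x ∈ S) (hy : y ∈ S) (hxy : x < y) :
    (∫ u in Set.Iio x, S.indicator w u) * w y ≤ (∫ u in Set.Iio y, S.indicator w u) * w x := by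
  have hshift : ∫ u in Set.Iio y, S.indicator w u =
      ∫ u in Set.Iio x, S.indicator w (u + (y - x)) := by
    rw [← integral_indicator measurableSet_Iio, ← integral_indicator measurableSet_Iio,
      ← integral_add_right_eq_self _ (y - x)]
    congr 1
    ext u
    simp only [Set.indicator_apply, Set.mem_Iio]
    congr 1
    rw [eq_iff_iff]
    constructor <;> intro h <;> linarith
  rw [hshift, ← integral_mul_const, ← integral_mul_const]
  refine setIntegral_mono_on (hi.mul_const _).integrableOn
    ((hi.comp_add_right _).mul_const _).integrableOn measurableSet_Iio fun u hu => ?_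
  exact indicator_sub_mul_le_of_concaveOn_log hw hconc hx hy (sub_pos.2 hxy) (by ring) (le_of_lt hu)

/-- The distribution function of a log-concave law lies below the exponential tangent to it. -/
theorem integral_Iio_indicator_le_mul_exp {S : Set ℝ} {w : ℝ → ℝ} (hS : IsOpen S)
    (h0 : (0 : ℝ) ∈ S) (hw : ∀ x ∈ S, 0 < w x) (hcont : ContinuousOn w S)
    (hconc : ConcaveOn ℝ S fun x => Real.log (w x)) (hi : Integrable (S.indicator w))
    {R : ℝ → ℝ} (hR : ∀ x, R x = ∫ u in Set.Iio x, S.indicator w u) :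
    0 < R 0 ∧ ∀ x, R x ≤ R 0 * Real.exp (w 0 / R 0 * x) := by
  have hf0 : ∀ x, 0 ≤ S.indicator w x := Set.indicator_nonneg fun z hz => (hw z hz).le
  have hsub : ∀ x y, R y - R x = ∫ u in x..y, S.indicator w u := fun x y => by
    rw [hR, hR, ← integral_Iic_eq_integral_Iio, ← integral_Iic_eq_integral_Iio,
      intervalIntegral.integral_Iic_sub_Iic hi.integrableOn hi.integrableOn]
  have hReq : R = fun x => R 0 + ∫ u in 0..x, S.indicator w u := by
    ext x; rw [← hsub]; ring
  have hRnn : ∀ x, 0 ≤ R x := fun x => by rw [hR]; exact integral_nonneg hf0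
  have hRc : Continuous R := by
    rw [hReq]
    exact continuous_const.add
      (intervalIntegral.continuous_primitive (fun a b => hi.intervalIntegrable) 0)
  have hder : ∀ x ∈ S, HasDerivAt R (w x) x := fun x hx => by
    have hev : S.indicator w =ᶠ[nhds x] w :=
      Filter.eventually_of_mem (hS.mem_nhds hx) fun y hy => Set.indicator_of_mem hy w
    have hca : ContinuousAt (S.indicator w) x :=
      ((hcont.continuousAt (hS.mem_nhds hx)).congr hev.symm)
    have h := (intervalIntegral.integral_hasDerivAt_right (a := 0) hi.intervalIntegrable
      hi.aestronglyMeasurable.stronglyMeasurableAtFilter hca).const_add (R 0)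
    rw [hReq, ← hev.eq_of_nhds]
    exact h
  have hR0 : 0 < R 0 := by
    refine lt_of_le_of_ne (hRnn 0) fun h => (hw 0 h0).ne' ?_
    exact IsLocalMin.hasDerivAt_eq_zero (Filter.Eventually.of_forall fun x => h ▸ hRnn x)
      (hder 0 h0)
  refine ⟨hR0, ?_⟩
  set c := w 0 / R 0 with hc
  have hc0 : 0 < c := div_pos (hw 0 h0) hR0
  have hratio : ∀ {x y : ℝ}, x ∈ S → y ∈ S → x < y → R x * w y ≤ R y * w x := by
    intro x y hx hy hxy
    rw [hR, hR]
    exact integral_Iio_indicator_mul_le_of_concaveOn_log hw hconc hi hx hy hxy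
  have hgder : ∀ x ∈ S, HasDerivAt (fun x => R x * Real.exp (-c * x))
      ((w x - c * R x) * Real.exp (-c * x)) x := fun x hx => by
    refine ((hder x hx).mul ((hasDerivAt_id x).const_mul (-c)).exp).congr_deriv ?_
    simp only [id]
    ring
  have hgS : ∀ x ∈ S, R x * Real.exp (-c * x) ≤ R 0 := by
    intro x hx
    have hgc : Continuous fun x => R x * Real.exp (-c * x) := by fun_prop
    rcases le_total 0 x with hx0 | hx0
    · have hsubS : Set.Icc 0 x ⊆ S := hconc.1.ordConnected.out h0 hx
      have := antitoneOn_of_hasDerivWithinAt_nonpos (convex_Icc 0 x) hgc.continuousOn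
        (fun y hy => (hgder y (hsubS (interior_subset hy))).hasDerivWithinAt) (fun y hy => by
          rw [interior_Icc] at hy
          have h := hratio h0 (hsubS (Set.Ioo_subset_Icc_self hy)) hy.1
          refine mul_nonpos_of_nonpos_of_nonneg ?_ (Real.exp_pos _).le
          rw [hc, sub_nonpos, div_mul_eq_mul_div, le_div_iff₀ hR0]
          linarith) ⟨le_rfl, hx0⟩ ⟨hx0, le_rfl⟩ hx0
      simpa using this
    · have hsubS : Set.Icc x 0 ⊆ S := hconc.1.ordConnected.out hx h0
      have := monotoneOn_of_hasDerivWithinAt_nonneg (convex_Icc x 0) hgc.continuousOn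
        (fun y hy => (hgder y (hsubS (interior_subset hy))).hasDerivWithinAt) (fun y hy => by
          rw [interior_Icc] at hy
          have h := hratio (hsubS (Set.Ioo_subset_Icc_self hy)) h0 hy.2
          refine mul_nonneg ?_ (Real.exp_pos _).le
          rw [hc, sub_nonneg, div_mul_eq_mul_div, div_le_iff₀ hR0]
          linarith) ⟨le_rfl, hx0⟩ ⟨hx0, le_rfl⟩ hx0
      simpa using this
  have hleS : ∀ x ∈ S, R x ≤ R 0 * Real.exp (c * x) := fun x hx => by
    have h := mul_le_mul_of_nonneg_right (hgS x hx) (Real.exp_pos (c * x)).le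
    rwa [mul_assoc, ← Real.exp_add, neg_mul, neg_add_cancel, Real.exp_zero, mul_one] at h
  intro x
  by_cases hxS : x ∈ S
  · exact hleS x hxS
  rcases le_total x 0 with hx0 | hx0
  · have : R x = 0 := by
      rw [hR]
      refine setIntegral_eq_zero_of_forall_eq_zero fun u hu => Set.indicator_of_notMem ?_ _
      exact fun huS => hxS (hconc.1.ordConnected.out huS h0 ⟨le_of_lt hu, hx0⟩)
    rw [this]
    positivity
  · have hub : ∀ u ∈ S, u ≤ x := fun u hu => by
      by_contra! h
      exact hxS (hconc.1.ordConnected.out h0 hu ⟨hx0, h.le⟩)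
    have hbdd : BddAbove S := ⟨x, hub⟩
    have hsupx : sSup S ≤ x := csSup_le ⟨0, h0⟩ hub
    have hclosed : IsClosed {y | R y ≤ R 0 * Real.exp (c * y)} :=
      isClosed_le hRc (by fun_prop)
    have hsup : R (sSup S) ≤ R 0 * Real.exp (c * sSup S) :=
      closure_minimal hleS hclosed (csSup_mem_closure ⟨0, h0⟩ hbdd)
    have hconst : R x = R (sSup S) := by
      rw [← sub_eq_zero, hsub, intervalIntegral.integral_of_le hsupx]
      refine setIntegral_eq_zero_of_forall_eq_zero fun u hu => Set.indicator_of_notMem ?_ _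
      exact fun huS => absurd (le_csSup hbdd huS) (not_le.2 hu.1)
    rw [hconst]
    exact hsup.trans (by gcongr)

theorem exists_indicator_le_mul_exp_neg {S : Set ℝ} {w : ℝ → ℝ} (hS : IsOpen S)
    (h0 : (0 : ℝ) ∈ S) (hw : ∀ x ∈ S, 0 < w x) (hconc : ConcaveOn ℝ S fun x => Real.log (w x))
    (hi : Integrable (S.indicator w)) :
    ∃ C r : ℝ, 0 < C ∧ 0 < r ∧ ∀ x, 0 ≤ x → S.indicator w x ≤ C * Real.exp (-r * x) := by
  have hw0 := hw 0 h0
  obtain ⟨y, hy0, hy⟩ : ∃ y, 0 < y ∧ S.indicator w y < w 0 := by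
    by_contra! h
    have hconst : IntegrableOn (fun _ : ℝ => w 0) (Set.Ioi 0) := by
      refine Integrable.mono' hi.integrableOn aestronglyMeasurable_const ?_
      filter_upwards [ae_restrict_mem measurableSet_Ioi] with x hx
      rw [Real.norm_of_nonneg hw0.le]
      exact h x hx
    simp [integrableOn_const_iff, hw0.ne'] at hconst
  obtain ⟨r, hr, hdecay⟩ : ∃ r, 0 < r ∧
      ∀ x, y < x → S.indicator w x ≤ w 0 * Real.exp (-r * x) := by
    by_cases hyS : y ∈ S
    · rw [Set.indicator_of_mem hyS] at hy
      have hlog := Real.log_lt_log (hw y hyS) hy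
      refine ⟨(Real.log (w 0) - Real.log (w y)) / y, div_pos (by linarith) hy0, fun x hx => ?_⟩
      by_cases hxS : x ∈ S
      · have hx0 : 0 < x := hy0.trans hx
        rw [Set.indicator_of_mem hxS, ← Real.log_le_log_iff (hw x hxS) (by positivity),
          Real.log_mul hw0.ne' (Real.exp_ne_zero _), Real.log_exp]
        have ht : y / x ≤ 1 := (div_le_one hx0).2 hx.le
        have h := hconc.2 h0 hxS (sub_nonneg.2 ht) (by positivity : 0 ≤ y / x) (by ring)
        have e : (1 - y / x) • (0 : ℝ) + (y / x) • x = y := by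
          simp only [smul_eq_mul]; field_simp; ring
        rw [e] at h
        simp only [smul_eq_mul] at h
        have h2 := mul_le_mul_of_nonneg_left h (by positivity : 0 ≤ x / y)
        have e1 : x / y * ((1 - y / x) * Real.log (w 0) + y / x * Real.log (w x)) =
            x / y * Real.log (w 0) - Real.log (w 0) + Real.log (w x) := by
          field_simp
        have e2 : -((Real.log (w 0) - Real.log (w y)) / y) * x =
            x / y * Real.log (w y) - x / y * Real.log (w 0) := by ring
        rw [e1] at h2
        rw [e2]
        linarith
      · rw [Set.indicator_of_notMem hxS]
        positivity
    · refine ⟨1, one_pos, fun x hx => ?_⟩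
      rw [Set.indicator_of_notMem fun hxS =>
        hyS (hconc.1.ordConnected.out h0 hxS ⟨hy0.le, hx.le⟩)]
      positivity
  obtain ⟨k, hk⟩ := exists_le_mul_exp_of_concaveOn_log hS h0 hw hconc
  refine ⟨w 0 * Real.exp ((|k| + r) * y), r, by positivity, hr, fun x hx => ?_⟩
  rw [mul_assoc, ← Real.exp_add]
  rcases le_or_gt x y with hxy | hxy
  · by_cases hxS : x ∈ S
    · rw [Set.indicator_of_mem hxS]
      refine (hk x hxS).trans ?_
      gcongr
      have h1 : k * x ≤ |k| * y :=
        (mul_le_mul_of_nonneg_right (le_abs_self k) hx).trans (by gcongr)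
      nlinarith
    · rw [Set.indicator_of_notMem hxS]
      positivity
  · refine (hdecay x hxy).trans ?_
    gcongr
    have : 0 ≤ (|k| + r) * y := by positivity
    linarith

theorem integrableOn_Ioi_sq_mul_indicator {S : Set ℝ} {w : ℝ → ℝ} (hS : IsOpen S)
    (h0 : (0 : ℝ) ∈ S) (hw : ∀ x ∈ S, 0 < w x) (hconc : ConcaveOn ℝ S fun x => Real.log (w x))
    (hi : Integrable (S.indicator w)) :
    IntegrableOn (fun x => x ^ 2 * S.indicator w x) (Set.Ioi 0) := by
  obtain ⟨C, r, hC, hr, hle⟩ := exists_indicator_le_mul_exp_neg hS h0 hw hconc hi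
  have hf0 : ∀ x, 0 ≤ S.indicator w x := Set.indicator_nonneg fun z hz => (hw z hz).le
  refine Integrable.mono' ((integrableOn_exp_mul_Ioi (a := -(r / 2)) (by linarith) 0).const_mul
    (8 / r ^ 2 * C)) (((measurable_id.pow_const 2).aestronglyMeasurable.mul
      hi.aestronglyMeasurable).restrict) ?_
  filter_upwards [ae_restrict_mem measurableSet_Ioi] with x (hx : 0 < x)
  rw [Real.norm_of_nonneg (mul_nonneg (sq_nonneg x) (hf0 x))]
  have hquad : x ^ 2 ≤ 8 / r ^ 2 * Real.exp (r / 2 * x) := by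
    have h := Real.quadratic_le_exp_of_nonneg (x := r / 2 * x) (by positivity)
    have h1 : (r / 2 * x) ^ 2 / 2 ≤ Real.exp (r / 2 * x) := by
      have : 0 ≤ r / 2 * x := by positivity
      linarith
    calc x ^ 2 = 8 / r ^ 2 * ((r / 2 * x) ^ 2 / 2) := by field_simp; norm_num
      _ ≤ _ := by gcongr
  calc x ^ 2 * S.indicator w x
      ≤ 8 / r ^ 2 * Real.exp (r / 2 * x) * (C * Real.exp (-r * x)) :=
        mul_le_mul hquad (hle x hx.le) (hf0 x) (by positivity)
    _ = 8 / r ^ 2 * C * (Real.exp (r / 2 * x) * Real.exp (-r * x)) := by ring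
    _ = _ := by rw [← Real.exp_add]; ring_nf

/-- An integrable log-concave function has a finite second moment. -/
theorem integrable_sq_mul_indicator {S : Set ℝ} {w : ℝ → ℝ} (hS : IsOpen S)
    (h0 : (0 : ℝ) ∈ S) (hw : ∀ x ∈ S, 0 < w x) (hconc : ConcaveOn ℝ S fun x => Real.log (w x))
    (hi : Integrable (S.indicator w)) : Integrable fun x => x ^ 2 * S.indicator w x := by
  have hpos := integrableOn_Ioi_sq_mul_indicator hS h0 hw hconc hi
  have hind : ∀ x, (Neg.neg ⁻¹' S).indicator (fun y => w (-y)) x = S.indicator w (-x) :=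
    fun _ => rfl
  have hneg := integrableOn_Ioi_sq_mul_indicator (S := Neg.neg ⁻¹' S) (w := fun y => w (-y))
    (hS.preimage continuous_neg) (by simpa using h0) (fun x hx => hw (-x) hx)
    (hconc.comp_linearMap (-LinearMap.id)) (by rw [funext hind]; exact hi.comp_neg)
  simp only [hind] at hneg
  have hneg' : IntegrableOn (fun x => x ^ 2 * S.indicator w x) (Set.Iio 0) := by
    have := ((integrable_indicator_iff measurableSet_Ici).2
      ((integrableOn_Ici_iff_integrableOn_Ioi (by simp)).2 hneg)).comp_neg
    rw [← integrableOn_Iic_iff_integrableOn_Iio, ← integrable_indicator_iff measurableSet_Iic]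
    refine this.congr (Filter.Eventually.of_forall fun x => ?_)
    by_cases hx : x ≤ 0 <;> simp [hx]
  rw [← integrableOn_univ, ← Set.Iio_union_Ici (a := (0 : ℝ))]
  exact hneg'.union ((integrableOn_Ici_iff_integrableOn_Ioi (by simp)).2 hpos)

theorem integrable_mul_of_integrable_sq_mul {f : ℝ → ℝ} (hi : Integrable f)
    (hi2 : Integrable fun x => x ^ 2 * f x) : Integrable fun x => x * f x := by
  refine Integrable.mono' (hi.norm.add hi2.norm)
    (measurable_id.aestronglyMeasurable.mul hi.aestronglyMeasurable)
    (Filter.Eventually.of_forall fun x => ?_)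
  simp only [Pi.add_apply, norm_mul, norm_pow, Real.norm_eq_abs]
  nlinarith [abs_nonneg (f x), sq_nonneg (|x| - 1),
    mul_nonneg (abs_nonneg (f x)) (sq_nonneg (|x| - 1)),
    mul_nonneg (abs_nonneg (f x)) (abs_nonneg x)]

theorem integral_indicator_Ioi_sub_indicator_Ioi (s : ℝ) :
    (Integrable fun x => (Set.Ioi s).indicator (1 : ℝ → ℝ) x - (Set.Ioi 0).indicator 1 x) ∧
    ∫ x, ((Set.Ioi s).indicator (1 : ℝ → ℝ) x - (Set.Ioi 0).indicator 1 x) = -s ∧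
    ∫ x, ‖(Set.Ioi s).indicator (1 : ℝ → ℝ) x - (Set.Ioi 0).indicator 1 x‖ = |s| := by
  rcases le_total s 0 with hs | hs
  · have heq : (fun x => (Set.Ioi s).indicator (1 : ℝ → ℝ) x - (Set.Ioi 0).indicator 1 x) =
        (Set.Ioc s 0).indicator 1 := by
      ext x
      by_cases h1 : s < x <;> by_cases h2 : 0 < x <;> simp [h1, h2, not_lt.1]
      all_goals linarith
    have hn : ∀ x, ‖(Set.Ioc s 0).indicator (1 : ℝ → ℝ) x‖ = (Set.Ioc s 0).indicator 1 x :=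
      fun x => Real.norm_of_nonneg (Set.indicator_nonneg (fun _ _ => zero_le_one) _)
    have heq' : ∀ x, (Set.Ioi s).indicator (1 : ℝ → ℝ) x - (Set.Ioi 0).indicator 1 x =
        (Set.Ioc s 0).indicator 1 x := congrFun heq
    simp only [heq', hn]
    refine ⟨(integrable_indicator_iff measurableSet_Ioc).2 (integrableOn_const (by simp)), ?_, ?_⟩ <;>
      rw [integral_indicator_one measurableSet_Ioc] <;>
      simp [Measure.real, abs_of_nonpos hs, hs]
  · have heq : (fun x => (Set.Ioi s).indicator (1 : ℝ → ℝ) x - (Set.Ioi 0).indicator 1 x) =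
        fun x => -(Set.Ioc 0 s).indicator 1 x := by
      ext x
      by_cases h1 : s < x <;> by_cases h2 : 0 < x <;> simp [h1, h2, not_lt.1]
      all_goals linarith
    have hn : ∀ x, ‖-(Set.Ioc 0 s).indicator (1 : ℝ → ℝ) x‖ = (Set.Ioc 0 s).indicator 1 x :=
      fun x => by rw [norm_neg]; exact Real.norm_of_nonneg (Set.indicator_nonneg (fun _ _ => zero_le_one) _)
    have heq' : ∀ x, (Set.Ioi s).indicator (1 : ℝ → ℝ) x - (Set.Ioi 0).indicator 1 x =
        -(Set.Ioc 0 s).indicator 1 x := congrFun heq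
    simp only [heq', hn]
    refine ⟨((integrable_indicator_iff measurableSet_Ioc).2 (integrableOn_const (by simp))).neg, ?_, ?_⟩ <;>
      (try rw [integral_neg]) <;> rw [integral_indicator_one measurableSet_Ioc] <;>
      simp [Measure.real, abs_of_nonneg hs, hs]

/-- The distribution function of a probability density differs from the Heaviside function by
an integrable function, whose integral is minus the mean. -/
theorem integral_cdf_sub_heaviside {f R : ℝ → ℝ} (hi : Integrable f)
    (hi1 : Integrable fun x => x * f x) (hmass : ∫ x, f x = 1)
    (hR : ∀ x, R x = ∫ u in Set.Iio x, f u) :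
    (Integrable fun x => R x - (Set.Ioi 0).indicator 1 x) ∧
    ∫ x, (R x - (Set.Ioi 0).indicator 1 x) = -∫ x, x * f x := by
  set G : ℝ → ℝ → ℝ := fun x s =>
    f s * ((Set.Ioi s).indicator (1 : ℝ → ℝ) x - (Set.Ioi 0).indicator 1 x) with hG
  have hGm : AEStronglyMeasurable (Function.uncurry G) (volume.prod volume) := by
    refine hi.aestronglyMeasurable.comp_snd.mul (Measurable.aestronglyMeasurable ?_)
    refine Measurable.sub ?_ ?_
    · have : (fun p : ℝ × ℝ => (Set.Ioi p.2).indicator (1 : ℝ → ℝ) p.1) =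
          {p : ℝ × ℝ | p.2 < p.1}.indicator 1 := by
        ext p; simp [Set.indicator_apply]
      rw [this]
      exact measurable_one.indicator (measurableSet_lt measurable_snd measurable_fst)
    · exact (measurable_one.indicator measurableSet_Ioi).comp measurable_fst
  have hGi : Integrable (Function.uncurry G) (volume.prod volume) := by
    rw [integrable_prod_iff' hGm]
    refine ⟨Filter.Eventually.of_forall fun s =>
      (integral_indicator_Ioi_sub_indicator_Ioi s).1.const_mul (f s), ?_⟩
    have : (fun s => ∫ x, ‖Function.uncurry G (x, s)‖) = fun s => ‖s * f s‖ := by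
      ext s
      simp only [Function.uncurry_apply_pair, hG, norm_mul]
      rw [integral_const_mul, (integral_indicator_Ioi_sub_indicator_Ioi s).2.2, mul_comm,
        Real.norm_eq_abs s]
    rw [this]
    exact hi1.norm
  have hGR : ∀ x, ∫ s, G x s = R x - (Set.Ioi 0).indicator 1 x := by
    intro x
    have h1 : ∀ s, G x s = (Set.Iio x).indicator f s - (Set.Ioi 0).indicator 1 x * f s := by
      intro s
      by_cases h : s < x <;> by_cases h' : 0 < x <;> simp [hG, h, h']
    simp only [h1]
    rw [integral_sub (hi.indicator measurableSet_Iio) (hi.const_mul _), integral_const_mul, hmass,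
      mul_one, integral_indicator measurableSet_Iio, hR]
  constructor
  · have := hGi.integral_prod_left
    simpa only [Function.uncurry_apply_pair, hGR] using this
  · have := integral_integral_swap hGi
    simp only [hGR] at this
    rw [this, ← integral_neg]
    congr 1
    ext s
    simp only [hG]
    rw [integral_const_mul, (integral_indicator_Ioi_sub_indicator_Ioi s).2.1]
    ring

theorem integral_truncatedExp_sub_heaviside {c : ℝ} (hc : 0 < c) {F : ℝ → ℝ}
    (hF : ∀ x, F x = if x ≤ 1 / c then Real.exp (c * x - 1) else 1) :
    (Integrable fun x => F x - (Set.Ioi 0).indicator 1 x) ∧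
    ∫ x, (F x - (Set.Ioi 0).indicator 1 x) = 0 := by
  have hc' : 0 < 1 / c := by positivity
  have heq : (fun x => F x - (Set.Ioi 0).indicator 1 x) = fun x =>
      (Set.Iic (1 / c)).indicator (fun y => Real.exp (-1) * Real.exp (c * y)) x -
        (Set.Ioc 0 (1 / c)).indicator 1 x := by
    ext x
    rw [hF]
    simp only [← Real.exp_add, neg_add_eq_sub]
    by_cases h : x ≤ 1 / c
    · by_cases h' : 0 < x <;> simp [h, h', -one_div]
    · have h' : 0 < x := hc'.trans (not_le.1 h)
      simp [h, h', -one_div]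
  have h1 : Integrable ((Set.Iic (1 / c)).indicator
      fun y => Real.exp (-1) * Real.exp (c * y)) :=
    (integrable_indicator_iff measurableSet_Iic).2
      ((integrableOn_exp_mul_Iic hc _).const_mul _)
  have h2 : Integrable ((Set.Ioc 0 (1 / c)).indicator (1 : ℝ → ℝ)) :=
    (integrable_indicator_iff measurableSet_Ioc).2 (integrableOn_const (by simp))
  rw [heq]
  refine ⟨h1.sub h2, ?_⟩
  rw [integral_sub h1 h2, integral_indicator measurableSet_Iic, integral_const_mul,
    integral_exp_mul_Iic hc, integral_indicator_one measurableSet_Ioc, mul_one_div_cancel hc.ne',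
    ← mul_div_assoc, ← Real.exp_add]
  simp [Measure.real, hc.le]

/-- Two functions differing from the Heaviside function by integrable functions of integral zero
are `L¹`-close as soon as a translate of one of them dominates both. -/
theorem integral_abs_sub_le_of_le_translate {R F : ℝ → ℝ} {t : ℝ}
    (hR : Integrable fun x => R x - (Set.Ioi 0).indicator 1 x)
    (hR0 : ∫ x, (R x - (Set.Ioi 0).indicator 1 x) = 0)
    (hF : Integrable fun x => F x - (Set.Ioi 0).indicator 1 x)
    (hF0 : ∫ x, (F x - (Set.Ioi 0).indicator 1 x) = 0)
    (hRF : ∀ x, R x ≤ F (x + t)) (hFF : ∀ x, F x ≤ F (x + t)) :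
    ∫ x, |R x - F x| ≤ 2 * t := by
  have hind : ∀ x, (Set.Ioi 0).indicator (1 : ℝ → ℝ) (x + t) =
      (Set.Ioi (-t)).indicator 1 x := fun x => by
    simp [Set.indicator_apply, neg_lt_iff_pos_add]
  have hFt := hF.comp_add_right t
  have hFt0 := (integral_add_right_eq_self
    (fun x => F x - (Set.Ioi 0).indicator (1 : ℝ → ℝ) x) t).trans hF0
  simp only [hind] at hFt hFt0
  obtain ⟨hH, hH0, -⟩ := integral_indicator_Ioi_sub_indicator_Ioi (-t)
  have hle : ∀ x, |R x - F x| ≤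
      2 * ((F (x + t) - (Set.Ioi (-t)).indicator 1 x) +
        ((Set.Ioi (-t)).indicator 1 x - (Set.Ioi 0).indicator 1 x)) -
      (F x - (Set.Ioi 0).indicator 1 x) - (R x - (Set.Ioi 0).indicator 1 x) := fun x =>
    abs_le.2 ⟨by linarith [hFF x], by linarith [hRF x]⟩
  have hint := (hFt.add hH).const_mul 2
  calc ∫ x, |R x - F x| ≤ _ := integral_mono_of_nonneg
        (Filter.Eventually.of_forall fun x => abs_nonneg _) ((hint.sub hF).sub hR)
        (Filter.Eventually.of_forall hle)
    _ = 2 * t := by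
      rw [integral_sub' (hint.sub hF) hR, integral_sub' hint hF, integral_const_mul]
      simp only [Pi.add_apply]
      rw [integral_add hFt hH, hFt0, hH0, hF0, hR0]
      ring

theorem isOpen_erealIoo (a b : EReal) : IsOpen (erealIoo a b) :=
  isOpen_Ioo.preimage continuous_coe_real_ereal

/-- Stability of the one-dimensional Grünbaum inequality for log-concave
densities: if the bound `∫_a^0 w ≥ e⁻¹` is almost attained, the cumulative
distribution function `R` of `w` is close in `L¹(ℝ)` to the cumulative
distribution function `F` of the truncated exponential model density. -/
theorem grunbaum_one_dim_logconcave_stability (ε : ℝ) (a b : EReal)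
    (w R F : ℝ → ℝ) (c : ℝ) (ha : a < (0 : EReal)) (hb : (0 : EReal) < b)
    (hw : ∀ x ∈ erealIoo a b, 0 < w x)
    (hcont : ContinuousOn w (erealIoo a b))
    (hint : IntegrableOn w (erealIoo a b))
    (hconc : ConcaveOn ℝ (erealIoo a b) (fun x => Real.log (w x)))
    (hmass : ∫ x in erealIoo a b, w x = 1)
    (hbar : ∫ x in erealIoo a b, x * w x = 0)
    (hR : ∀ x : ℝ, R x = ∫ s in erealIoo a b ∩ Set.Iio x, w s)
    (hc : c = w 0 / R 0)
    (hF : ∀ x : ℝ, F x = if x ≤ 1 / c then Real.exp (c * x - 1) else 1)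
    (hε : 0 < ε)
    (hclose : R 0 ≤ (1 + ε) * Real.exp (-1)) :
    (∫ x : ℝ, |R x - F x|) ≤
      4 * Real.sqrt 3 / Real.exp 1 * (1 + ε) * Real.log (1 + ε) *
        (∫ x in erealIoo a b, x ^ 2 * w x) ^ ((1 : ℝ) / 2) := by
  set S := erealIoo a b
  have hS : IsOpen S := isOpen_erealIoo a b
  have hSm : MeasurableSet S := hS.measurableSet
  have h0 : (0 : ℝ) ∈ S := ⟨ha, hb⟩
  have hw0 := hw 0 h0
  have hf0 : ∀ x, 0 ≤ S.indicator w x := Set.indicator_nonneg fun z hz => (hw z hz).le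
  have hi : Integrable (S.indicator w) := (integrable_indicator_iff hSm).2 hint
  have hi2 := integrable_sq_mul_indicator hS h0 hw hconc hi
  have hi1 := integrable_mul_of_integrable_sq_mul hi hi2
  have hset : ∀ g : ℝ → ℝ, ∫ x in S, g x * w x = ∫ x, g x * S.indicator w x := fun g => by
    rw [← integral_indicator hSm]
    simp only [Set.indicator_mul_right]
  rw [← integral_indicator hSm] at hmass
  rw [hset fun x => x] at hbar
  rw [hset fun x => x ^ 2, ← Real.sqrt_eq_rpow]
  have hR' : ∀ x, R x = ∫ u in Set.Iio x, S.indicator w u := fun x => by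
    rw [hR, setIntegral_indicator hSm, Set.inter_comm]
  obtain ⟨hR0, hRexp⟩ := integral_Iio_indicator_le_mul_exp hS h0 hw hcont hconc hi hR'
  rw [← hc] at hRexp
  have hcpos : 0 < c := hc ▸ div_pos hw0 hR0
  have hL : 0 < Real.log (1 + ε) := Real.log_pos (by linarith)
  have hR1 : ∀ x, R x ≤ 1 := fun x => by
    rw [hR', ← hmass]
    exact setIntegral_le_integral hi (Filter.Eventually.of_forall hf0)
  have ht : 0 < Real.log (1 + ε) / c := by positivity
  have hF1 : ∀ x, F x ≤ 1 := fun x => by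
    rw [hF]
    split_ifs with h
    · rw [Real.exp_le_one_iff]
      linarith [(le_div_iff₀' hcpos).1 h]
    · exact le_rfl
  have hFF : ∀ x, F x ≤ F (x + Real.log (1 + ε) / c) := fun x => by
    rw [hF (x + _)]
    split_ifs with h
    · rw [hF, if_pos (by linarith)]
      gcongr
      linarith
    · exact hF1 x
  have hRF : ∀ x, R x ≤ F (x + Real.log (1 + ε) / c) := fun x => by
    rw [hF]
    split_ifs with h
    · calc R x ≤ R 0 * Real.exp (c * x) := hRexp x
        _ ≤ (1 + ε) * Real.exp (-1) * Real.exp (c * x) := by gcongr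
        _ = Real.exp (Real.log (1 + ε)) * Real.exp (-1) * Real.exp (c * x) := by
          rw [Real.exp_log (by linarith)]
        _ = _ := by
          rw [← Real.exp_add, ← Real.exp_add]
          congr 1
          field_simp
          ring
    · exact hR1 x
  obtain ⟨hRi, hRz⟩ := integral_cdf_sub_heaviside hi hi1 hmass hR'
  obtain ⟨hFi, hFz⟩ := integral_truncatedExp_sub_heaviside hcpos hF
  have hmain := integral_abs_sub_le_of_le_translate hRi (by rw [hRz, hbar, neg_zero]) hFi hFz
    hRF hFF
  obtain ⟨k, hk⟩ := exists_le_mul_exp_of_concaveOn_log hS h0 hw hconc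
  have hvar := one_le_twelve_mul_sq_mul_integral (k := k) hw0 hf0
    (fun x => Set.indicator_le' hk (fun _ _ => by positivity) x) hi hi1 hi2 hmass hbar
  set V := ∫ x, x ^ 2 * S.indicator w x
  have hsd : 1 / w 0 ≤ 2 * Real.sqrt 3 * Real.sqrt V := by
    rw [div_le_iff₀ hw0]
    calc (1 : ℝ) ≤ Real.sqrt (12 * w 0 ^ 2 * V) := Real.one_le_sqrt.2 hvar
      _ = Real.sqrt ((2 * w 0) ^ 2 * (3 * V)) := by ring_nf
      _ = 2 * Real.sqrt 3 * Real.sqrt V * w 0 := by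
        rw [Real.sqrt_mul (sq_nonneg _), Real.sqrt_sq (by positivity),
          Real.sqrt_mul (by norm_num)]
        ring
  calc ∫ x, |R x - F x| ≤ 2 * (Real.log (1 + ε) / c) := hmain
    _ = 2 * Real.log (1 + ε) * (R 0 * (1 / w 0)) := by rw [hc]; field_simp
    _ ≤ 2 * Real.log (1 + ε) *
        ((1 + ε) * Real.exp (-1) * (2 * Real.sqrt 3 * Real.sqrt V)) := by gcongr
    _ = _ := by rw [Real.exp_neg]; ring
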